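/- Block constancy of two-step coefficients off the diagonal ordering: let λ be a Young diagram with at most d rows and let i, j ∈ [d]. Let k, k', ℓ, ℓ' ∈ [d] satisfy λ_k = λ_{k'} and λ_ℓ = λ_{ℓ'} (so k and k' lie in a common block of λ, and likewise ℓ and ℓ'). If either (k < ℓ and k' < ℓ') or (k > ℓ and k' > ℓ'), then g(k, ℓ) = g(k', ℓ'). -/

import Mathlib

open Finset

/-- The Weyl dimension polynomial `WD_p(mu) = prod_{1 <= a < b <= p} ((mu_a - mu_b) + (b - a))/(b - a)`
of the integer tuple `(mu 1, ..., mu p)`. -/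
def weylDim (p : ℕ) (μ : ℕ → ℤ) : ℚ :=
  ∏ a ∈ Finset.Icc 1 p, ∏ b ∈ Finset.Icc (a + 1) p,
    (((μ a : ℚ) - (μ b : ℚ)) + ((b : ℚ) - (a : ℚ))) / ((b : ℚ) - (a : ℚ))

/-- `addBox μ y = μ + e_y`: the tuple `μ` with `1` added in coordinate `y`. -/
def addBox (μ : ℕ → ℤ) (y : ℕ) : ℕ → ℤ := fun x => μ x + if x = y then 1 else 0

/-- The dimension ratio `D^μ_{k→y} = WD_k(μ + e_y)/WD_k(μ)` for `y ≤ k`, and `0` for `k < y`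
(division by zero evaluates to `0`). -/
def dimRatio (μ : ℕ → ℤ) (k y : ℕ) : ℚ :=
  if y ≤ k then weylDim k (addBox μ y) / weylDim k μ else 0

def intOf (lam : ℕ → ℕ) : ℕ → ℤ := fun x => (lam x : ℤ)

/-- `Δ = (λ_j − λ_i) + (i − j) + δ_{ij}`. -/
def Del (lam : ℕ → ℕ) (i j : ℕ) : ℚ :=
  (((lam j : ℚ) - (lam i : ℚ)) + ((i : ℚ) - (j : ℚ))) + (if i = j then 1 else 0)

/-- The partial-sum function `F(s, t)` of squared two-step Clebsch–Gordan coefficients. -/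
def Fcoef (lam : ℕ → ℕ) (i j : ℕ) (s t : ℕ) : ℚ :=
  if s ≤ t then dimRatio (intOf lam) s i * dimRatio (addBox (intOf lam) i) t j
  else
    dimRatio (intOf lam) t j * dimRatio (addBox (intOf lam) j) s i
      + 1 / Del lam i j ^ 2 *
          (dimRatio (intOf lam) t i * dimRatio (addBox (intOf lam) i) s j
            - dimRatio (intOf lam) t j * dimRatio (addBox (intOf lam) j) s i)

/-- The squared two-step Clebsch–Gordan coefficient `g(k, ℓ)`. -/
def gcoef (lam : ℕ → ℕ) (i j : ℕ) (k l : ℕ) : ℚ :=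
  Fcoef lam i j k l - Fcoef lam i j (k - 1) l - Fcoef lam i j k (l - 1)
    + Fcoef lam i j (k - 1) (l - 1)

/-- `D_{s→ij}`. -/
def dimR2 (lam : ℕ → ℕ) (i j s : ℕ) : ℚ :=
  if max i j ≤ s then weylDim s (addBox (addBox (intOf lam) i) j) / weylDim s (intOf lam)
  else 0

/-- `C^{λ+e_i}_j = λ_j + δ_{ij} − j`. -/
def rowContentAdd (lam : ℕ → ℕ) (i j : ℕ) : ℚ :=
  ((lam j : ℚ) + (if i = j then 1 else 0)) - (j : ℚ)

lemma weylDim_ne_zero {p : ℕ} {μ : ℕ → ℤ} (h : AntitoneOn μ (Set.Icc 1 p)) :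
    weylDim p μ ≠ 0 := by
  unfold weylDim
  refine Finset.prod_ne_zero_iff.2 fun a ha => Finset.prod_ne_zero_iff.2 fun b hb => ?_
  simp only [Finset.mem_Icc] at ha hb
  have hμ : (μ b : ℚ) ≤ μ a := by
    exact_mod_cast h ⟨ha.1, ha.2⟩ ⟨by omega, hb.2⟩ (by omega)
  have hab : (a : ℚ) + 1 ≤ b := by exact_mod_cast hb.1
  exact div_ne_zero (by linarith) (by linarith)

lemma weylDim_eq_zero {p a : ℕ} {μ : ℕ → ℤ} (ha : 1 ≤ a) (hp : a + 1 ≤ p)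
    (h : μ (a + 1) = μ a + 1) : weylDim p μ = 0 := by
  unfold weylDim
  refine Finset.prod_eq_zero (i := a) (by simp; omega)
    (Finset.prod_eq_zero (i := a + 1) (by simp; omega) ?_)
  rw [h]
  push_cast
  ring

lemma weylDim_succ (p : ℕ) (μ : ℕ → ℤ) :
    weylDim (p + 1) μ = weylDim p μ * ∏ a ∈ Finset.Icc 1 p,
      (((μ a : ℚ) - (μ (p + 1) : ℚ)) + (((p + 1 : ℕ) : ℚ) - (a : ℚ))) /
        (((p + 1 : ℕ) : ℚ) - (a : ℚ)) := by
  unfold weylDim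
  rw [Finset.prod_Icc_succ_top (by omega), ← Finset.prod_mul_distrib]
  rw [Finset.Icc_eq_empty (show ¬ p + 1 + 1 ≤ p + 1 by omega), Finset.prod_empty, mul_one]
  refine Finset.prod_congr rfl fun a ha => ?_
  rw [Finset.mem_Icc] at ha
  rw [Finset.prod_Icc_succ_top (by omega)]

lemma dimRatio_of_lt {μ : ℕ → ℤ} {k y : ℕ} (h : k < y) : dimRatio μ k y = 0 :=
  if_neg (by omega)

lemma dimRatio_succ {μ : ℕ → ℤ} {k y : ℕ} (h : AntitoneOn μ (Set.Icc 1 (k + 1)))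
    (hy : 1 ≤ y) (hyk : y ≤ k) :
    dimRatio μ (k + 1) y =
      dimRatio μ k y * (1 + 1 / (((μ y : ℚ) - μ (k + 1)) + ((k : ℚ) + 1 - y))) := by
  have hymem : y ∈ Finset.Icc 1 k := Finset.mem_Icc.2 ⟨hy, hyk⟩
  have hne := weylDim_ne_zero h
  rw [dimRatio, dimRatio, if_pos hyk, if_pos (by omega)]
  rw [weylDim_succ] at hne
  rw [weylDim_succ, weylDim_succ]
  rw [← Finset.mul_prod_erase _ _ hymem] at hne ⊢
  rw [← Finset.mul_prod_erase _ _ hymem]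
  have hrest : ∏ a ∈ (Finset.Icc 1 k).erase y,
      (((addBox μ y a : ℚ) - (addBox μ y (k + 1) : ℚ)) + (((k + 1 : ℕ) : ℚ) - (a : ℚ))) /
        (((k + 1 : ℕ) : ℚ) - (a : ℚ)) = ∏ a ∈ (Finset.Icc 1 k).erase y,
      (((μ a : ℚ) - (μ (k + 1) : ℚ)) + (((k + 1 : ℕ) : ℚ) - (a : ℚ))) /
        (((k + 1 : ℕ) : ℚ) - (a : ℚ)) := by
    refine Finset.prod_congr rfl fun a ha => ?_
    have h1 : a ≠ y := Finset.ne_of_mem_erase ha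
    have h2 : k + 1 ≠ y := by omega
    simp [addBox, h1, h2]
  rw [hrest]
  have h2 : k + 1 ≠ y := by omega
  simp only [addBox, if_true, if_neg h2, add_zero]
  generalize ∏ a ∈ (Finset.Icc 1 k).erase y,
      (((μ a : ℚ) - (μ (k + 1) : ℚ)) + (((k + 1 : ℕ) : ℚ) - (a : ℚ))) /
        (((k + 1 : ℕ) : ℚ) - (a : ℚ)) = P at hne ⊢
  simp only [mul_ne_zero_iff, div_ne_zero_iff] at hne
  obtain ⟨hW, ⟨hn, hd⟩, hP⟩ := hne
  push_cast at hn hd ⊢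
  change weylDim k (addBox μ y) * _ / _ = _
  field_simp
  ring

lemma dimRatio_eq_zero {μ : ℕ → ℤ} {k a : ℕ} (ha : 1 ≤ a) (h : μ (a + 1) = μ a) :
    dimRatio μ k (a + 1) = 0 := by
  unfold dimRatio
  split_ifs with hk
  · rw [weylDim_eq_zero ha hk (by simp [addBox, h]), zero_div]
  · rfl

lemma dimRatio_sub_succ {μ : ℕ → ℤ} {k y : ℕ} (h : AntitoneOn μ (Set.Icc 1 (k + 1)))
    (hy : 1 ≤ y) (hk : 1 ≤ k) (hμ : μ (k + 1) = μ k) :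
    dimRatio μ (k + 1) y - dimRatio μ k y = dimRatio μ k y - dimRatio μ (k - 1) y := by
  obtain ⟨m, rfl⟩ : ∃ m, k = m + 1 := ⟨k - 1, by omega⟩
  rw [Nat.add_sub_cancel]
  rcases lt_trichotomy y (m + 1) with hlt | rfl | hgt
  · rw [dimRatio_succ h hy (by omega), hμ,
      dimRatio_succ (h.mono (Set.Icc_subset_Icc_right (by omega))) hy (by omega)]
    have h1 : (μ (m + 1) : ℚ) ≤ μ y := by
      exact_mod_cast h ⟨hy, by omega⟩ ⟨hk, by omega⟩ hlt.le
    have h2 : (y : ℚ) ≤ m := by exact_mod_cast Nat.lt_succ_iff.1 hlt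
    have h3 : ((μ y : ℚ) - μ (m + 1)) + ((m : ℚ) + 1 - y) ≠ 0 := by linarith
    have h4 : ((μ y : ℚ) - μ (m + 1)) + (((m + 1 : ℕ) : ℚ) + 1 - y) ≠ 0 := by
      push_cast; linarith
    push_cast at h4 ⊢
    field_simp
    ring
  · rw [dimRatio_succ h hy le_rfl, hμ, dimRatio_of_lt (Nat.lt_succ_self m)]
    push_cast
    ring
  · rw [dimRatio_of_lt hgt, dimRatio_of_lt (show m < y by omega)]
    rcases (show m + 1 + 1 ≤ y from hgt).eq_or_lt with rfl | hlt
    · rw [dimRatio_eq_zero hk hμ]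
    · rw [dimRatio_of_lt hlt]

lemma dimRatio_sub_eq_of_le {μ : ℕ → ℤ} {d k k' y : ℕ} (h : AntitoneOn μ (Set.Icc 1 d))
    (hy : 1 ≤ y) (hk : 1 ≤ k) (hkk' : k ≤ k') (hk' : k' ≤ d) (hμ : μ k = μ k') :
    dimRatio μ k y - dimRatio μ (k - 1) y = dimRatio μ k' y - dimRatio μ (k' - 1) y := by
  induction k', hkk' using Nat.le_induction with
  | base => rfl
  | succ n hn ih =>
    have h1 : μ (n + 1) ≤ μ n := h ⟨by omega, by omega⟩ ⟨by omega, hk'⟩ (by omega)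
    have h2 : μ n ≤ μ k := h ⟨hk, by omega⟩ ⟨by omega, by omega⟩ hn
    rw [ih (by omega) (by omega), Nat.add_sub_cancel]
    exact (dimRatio_sub_succ (h.mono (Set.Icc_subset_Icc_right hk')) hy (by omega)
      (by omega)).symm

/-- The dimension ratio is affine in the truncation on each block of equal rows. -/
lemma dimRatio_sub_eq {μ : ℕ → ℤ} {d k k' y : ℕ} (h : AntitoneOn μ (Set.Icc 1 d))
    (hy : 1 ≤ y) (hk : k ∈ Finset.Icc 1 d) (hk' : k' ∈ Finset.Icc 1 d) (hμ : μ k = μ k') :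
    dimRatio μ k y - dimRatio μ (k - 1) y = dimRatio μ k' y - dimRatio μ (k' - 1) y := by
  rw [Finset.mem_Icc] at hk hk'
  rcases le_total k k' with hle | hle
  · exact dimRatio_sub_eq_of_le h hy hk.1 hle hk'.2 hμ
  · exact (dimRatio_sub_eq_of_le h hy hk'.1 hle hk.2 hμ.symm).symm

lemma antitoneOn_addBox {μ : ℕ → ℤ} {d i : ℕ} (h : AntitoneOn μ (Set.Icc 1 d))
    (hi : 1 ≤ i) (htop : ∀ a, 1 ≤ a → i = a + 1 → μ i ≠ μ a) :
    AntitoneOn (addBox μ i) (Set.Icc 1 d) := by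
  rintro a ⟨ha1, had⟩ b ⟨hb1, hbd⟩ hab
  have hμ := h ⟨ha1, had⟩ ⟨hb1, hbd⟩ hab
  unfold addBox
  by_cases hb : b = i
  · subst hb
    by_cases hab' : a = b
    · simp [hab']
    · have h1 := htop (b - 1) (by omega) (by omega)
      have h2 := h (a := b - 1) (b := b) ⟨by omega, by omega⟩ ⟨hb1, hbd⟩ (by omega)
      have h3 := h (a := a) (b := b - 1) ⟨ha1, had⟩ ⟨by omega, by omega⟩ (by omega)
      simp only [if_true, if_neg hab']
      omega
  · simp only [if_neg hb]
    split_ifs <;> omega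

lemma twoStep_sub_mul_sub_eq {μ : ℕ → ℤ} {d i j k k' l l' : ℕ}
    (h : AntitoneOn μ (Set.Icc 1 d)) (hi : i ∈ Finset.Icc 1 d) (hj : j ∈ Finset.Icc 1 d)
    (hk : k ∈ Finset.Icc 1 d) (hk' : k' ∈ Finset.Icc 1 d)
    (hl : l ∈ Finset.Icc 1 d) (hl' : l' ∈ Finset.Icc 1 d)
    (hkk' : μ k = μ k') (hll' : μ l = μ l') (hkl : k < l) (hkl' : k' < l') :
    (dimRatio μ k i - dimRatio μ (k - 1) i) *
        (dimRatio (addBox μ i) l j - dimRatio (addBox μ i) (l - 1) j) =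
      (dimRatio μ k' i - dimRatio μ (k' - 1) i) *
        (dimRatio (addBox μ i) l' j - dimRatio (addBox μ i) (l' - 1) j) := by
  have hkeq := dimRatio_sub_eq (y := i) h (Finset.mem_Icc.1 hi).1 hk hk' hkk'
  by_cases htop : ∀ a, 1 ≤ a → i = a + 1 → μ i ≠ μ a
  · by_cases hil : l = i
    · rw [← hkeq, dimRatio_of_lt (show k < i by omega),
        dimRatio_of_lt (show k - 1 < i by omega)]
      simp
    by_cases hil' : l' = i
    · rw [hkeq, dimRatio_of_lt (show k' < i by omega),
        dimRatio_of_lt (show k' - 1 < i by omega)]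
      simp
    rw [hkeq, dimRatio_sub_eq (antitoneOn_addBox h (Finset.mem_Icc.1 hi).1 htop)
      (Finset.mem_Icc.1 hj).1 hl hl' (by simp [addBox, hil, hil', hll'])]
  · push Not at htop
    obtain ⟨a, ha, rfl, hμ⟩ := htop
    simp [dimRatio_eq_zero ha hμ]

lemma addBox_comm (μ : ℕ → ℤ) (i j : ℕ) :
    addBox (addBox μ i) j = addBox (addBox μ j) i := by
  funext x
  simp only [addBox]
  ring

lemma dimRatio_mul_dimRatio_eq_zero {μ : ℕ → ℤ} {t i j : ℕ} (h : i ≤ t → j ≤ t → False) :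
    dimRatio μ t i * dimRatio (addBox μ i) t j = 0 := by
  rcases le_or_gt i t with hi | hi
  · rw [dimRatio_of_lt (not_le.1 (h hi)), mul_zero]
  · rw [dimRatio_of_lt hi, zero_mul]

lemma dimRatio_mul_dimRatio_of_top {μ : ℕ → ℤ} {t i j : ℕ} (h : AntitoneOn μ (Set.Icc 1 t))
    (hi : 1 ≤ i) (hit : i ≤ t) (hjt : j ≤ t)
    (htop : ∀ a, 1 ≤ a → i = a + 1 → μ i ≠ μ a) :
    dimRatio μ t i * dimRatio (addBox μ i) t j =
      weylDim t (addBox (addBox μ i) j) / weylDim t μ := by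
  rw [dimRatio, dimRatio, if_pos hit, if_pos hjt]
  have h1 := weylDim_ne_zero (antitoneOn_addBox h hi htop)
  have h2 := weylDim_ne_zero h
  field_simp

/-- On the diagonal the two orders of adding boxes agree, unless one of the intermediate tuples
is not weakly decreasing while the final one is; then the rows are adjacent in a common block. -/
lemma dimRatio_mul_dimRatio_comm_or {μ : ℕ → ℤ} {t i j : ℕ} (h : AntitoneOn μ (Set.Icc 1 t))
    (hi : 1 ≤ i) (hj : 1 ≤ j) :
    dimRatio μ t i * dimRatio (addBox μ i) t j = dimRatio μ t j * dimRatio (addBox μ j) t i ∨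
      (μ i = μ j ∧ (i = j + 1 ∨ j = i + 1)) := by
  by_cases ht : i ≤ t ∧ j ≤ t
  swap
  · left
    rw [dimRatio_mul_dimRatio_eq_zero (fun h1 h2 => ht ⟨h1, h2⟩),
      dimRatio_mul_dimRatio_eq_zero (fun h1 h2 => ht ⟨h2, h1⟩)]
  obtain ⟨hit, hjt⟩ := ht
  by_cases hij : i = j
  · subst hij
    exact Or.inl rfl
  by_cases hti : ∀ a, 1 ≤ a → i = a + 1 → μ i ≠ μ a <;>
    by_cases htj : ∀ a, 1 ≤ a → j = a + 1 → μ j ≠ μ a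
  · left
    rw [dimRatio_mul_dimRatio_of_top h hi hit hjt hti,
      dimRatio_mul_dimRatio_of_top h hj hjt hit htj, addBox_comm]
  · push Not at htj
    obtain ⟨a, ha, rfl, hμ⟩ := htj
    by_cases hai : i = a
    · subst hai
      exact Or.inr ⟨hμ.symm, Or.inr rfl⟩
    · left
      rw [dimRatio_mul_dimRatio_of_top h hi hit hjt hti, dimRatio_eq_zero ha hμ,
        weylDim_eq_zero ha hjt, zero_div, zero_mul]
      simp [addBox, hμ, Ne.symm hij, Ne.symm hai]
  · push Not at hti
    obtain ⟨a, ha, rfl, hμ⟩ := hti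
    by_cases haj : j = a
    · subst haj
      exact Or.inr ⟨hμ, Or.inl rfl⟩
    · left
      rw [dimRatio_mul_dimRatio_of_top h hj hjt hit htj, dimRatio_eq_zero ha hμ,
        weylDim_eq_zero ha hit, zero_div, zero_mul]
      simp [addBox, hμ, hij, Ne.symm haj]
  · push Not at hti htj
    obtain ⟨a, ha, rfl, hμ⟩ := hti
    obtain ⟨b, hb, rfl, hν⟩ := htj
    left
    rw [dimRatio_eq_zero ha hμ, dimRatio_eq_zero hb hν, zero_mul, zero_mul]

/-- The formula for `Fcoef` below the diagonal also holds on the diagonal. -/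
lemma Fcoef_of_le {lam : ℕ → ℕ} {i j s t : ℕ} (h : AntitoneOn (intOf lam) (Set.Icc 1 t))
    (hi : 1 ≤ i) (hj : 1 ≤ j) (hts : t ≤ s) :
    Fcoef lam i j s t =
      dimRatio (intOf lam) t j * dimRatio (addBox (intOf lam) j) s i
        + 1 / Del lam i j ^ 2 *
          (dimRatio (intOf lam) t i * dimRatio (addBox (intOf lam) i) s j
            - dimRatio (intOf lam) t j * dimRatio (addBox (intOf lam) j) s i) := by
  unfold Fcoef
  split_ifs with hst
  · obtain rfl : s = t := le_antisymm hst hts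
    rcases dimRatio_mul_dimRatio_comm_or h hi hj with heq | ⟨heq, hadj⟩
    · rw [heq]
      ring
    · have hlam : lam i = lam j := by simpa [intOf] using heq
      have hDel : Del lam i j ^ 2 = 1 := by
        rcases hadj with rfl | rfl <;> simp [Del, hlam]
      rw [hDel]
      ring
  · rfl

lemma gcoef_of_lt {lam : ℕ → ℕ} {i j k l : ℕ} (hkl : k < l) :
    gcoef lam i j k l =
      (dimRatio (intOf lam) k i - dimRatio (intOf lam) (k - 1) i) *
        (dimRatio (addBox (intOf lam) i) l j - dimRatio (addBox (intOf lam) i) (l - 1) j) := by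
  unfold gcoef Fcoef
  rw [if_pos (by omega), if_pos (by omega), if_pos (by omega), if_pos (by omega)]
  ring

lemma gcoef_of_gt {lam : ℕ → ℕ} {d i j k l : ℕ} (h : AntitoneOn (intOf lam) (Set.Icc 1 d))
    (hi : 1 ≤ i) (hj : 1 ≤ j) (hl : l ≤ d) (hkl : l < k) :
    gcoef lam i j k l =
      (1 - 1 / Del lam i j ^ 2) *
        ((dimRatio (intOf lam) l j - dimRatio (intOf lam) (l - 1) j) *
          (dimRatio (addBox (intOf lam) j) k i - dimRatio (addBox (intOf lam) j) (k - 1) i))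
      + 1 / Del lam i j ^ 2 *
        ((dimRatio (intOf lam) l i - dimRatio (intOf lam) (l - 1) i) *
          (dimRatio (addBox (intOf lam) i) k j
            - dimRatio (addBox (intOf lam) i) (k - 1) j)) := by
  have h1 := h.mono (Set.Icc_subset_Icc_right hl)
  have h2 := h.mono (Set.Icc_subset_Icc_right ((Nat.sub_le l 1).trans hl))
  unfold gcoef
  rw [Fcoef_of_le h1 hi hj (by omega), Fcoef_of_le h1 hi hj (by omega),
    Fcoef_of_le h2 hi hj (by omega), Fcoef_of_le h2 hi hj (by omega)]
  ring

lemma antitoneOn_intOf {d : ℕ} {lam : ℕ → ℕ}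
    (hlam : ∀ k, 1 ≤ k → k + 1 ≤ d → lam (k + 1) ≤ lam k) :
    AntitoneOn (intOf lam) (Set.Icc 1 d) := by
  rintro a ⟨ha, -⟩ b ⟨-, hb⟩ hab
  induction b, hab using Nat.le_induction with
  | base => exact le_rfl
  | succ n hn ih =>
    exact (Int.ofNat_le.2 (hlam n (by omega) hb)).trans (ih (by omega))

theorem block_constancy_two_step
    (d : ℕ) (hd : 1 ≤ d) (lam : ℕ → ℕ)
    (hlam : ∀ k, 1 ≤ k → k + 1 ≤ d → lam (k + 1) ≤ lam k)
    (i j : ℕ) (hi : i ∈ Finset.Icc 1 d) (hj : j ∈ Finset.Icc 1 d)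
    (k k' l l' : ℕ)
    (hk : k ∈ Finset.Icc 1 d) (hk' : k' ∈ Finset.Icc 1 d)
    (hl : l ∈ Finset.Icc 1 d) (hl' : l' ∈ Finset.Icc 1 d)
    (hkk' : lam k = lam k') (hll' : lam l = lam l')
    (horder : (k < l ∧ k' < l') ∨ (l < k ∧ l' < k')) :
    gcoef lam i j k l = gcoef lam i j k' l' := by
  have h := antitoneOn_intOf hlam
  have hμk : intOf lam k = intOf lam k' := congrArg Int.ofNat hkk'
  have hμl : intOf lam l = intOf lam l' := congrArg Int.ofNat hll'
  rcases horder with ⟨h1, h2⟩ | ⟨h1, h2⟩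
  · rw [gcoef_of_lt h1, gcoef_of_lt h2]
    exact twoStep_sub_mul_sub_eq h hi hj hk hk' hl hl' hμk hμl h1 h2
  · have hi1 := (Finset.mem_Icc.1 hi).1
    have hj1 := (Finset.mem_Icc.1 hj).1
    rw [gcoef_of_gt h hi1 hj1 (Finset.mem_Icc.1 hl).2 h1,
      gcoef_of_gt h hi1 hj1 (Finset.mem_Icc.1 hl').2 h2,
      twoStep_sub_mul_sub_eq h hj hi hl hl' hk hk' hμl hμk h1 h2,
      twoStep_sub_mul_sub_eq h hi hj hl hl' hk hk' hμl hμk h1 h2]
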